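/- Let (ζ^k)_{k≥1} = (u^k, v^k, w^k)_{k≥1} be the iterates of the HBCD scheme with stepsize η = (ε/‖C̃‖_∞²) · exp(−6‖C‖_∞/ε), and let F* be the optimal value of the dual entropic TiOT problem. Then for every k ≥ 1, F(ζ^k) − F* ≤ ρ₁ρ₂/k, where ρ₁ = (192m + 216n + 24) (‖C‖_∞²/ε) exp(18‖C‖_∞/ε) and ρ₂ = max{4/ρ₁ − 2, F(ζ¹) − F*, 2}. -/

import Mathlib

open Finset Filter Topology

noncomputable section

/-- Cost matrix `C(w)_{ij} = w‖x_i − y_j‖_p^p + (1−w)|t_i − s_j|^p`. -/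
def costM {d m n : ℕ} (p : ℝ) (x : Fin m → Fin d → ℝ) (t : Fin m → ℝ)
    (y : Fin n → Fin d → ℝ) (s : Fin n → ℝ) (w : ℝ) : Matrix (Fin m) (Fin n) ℝ :=
  fun i j => w * (∑ l, |x i l - y j l| ^ p) + (1 - w) * |t i - s j| ^ p

/-- The transport polytope `Π(a,b)`. -/
def transportPolytope {m n : ℕ} (a : Fin m → ℝ) (b : Fin n → ℝ) :
    Set (Matrix (Fin m) (Fin n) ℝ) :=
  {π | (∀ i j, 0 ≤ π i j) ∧ (∀ i, ∑ j, π i j = a i) ∧ (∀ j, ∑ i, π i j = b j)}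

/-- Frobenius pairing `⟨C, π⟩ = Σ_{i,j} C_{ij} π_{ij}`. -/
def ip {m n : ℕ} (C π : Matrix (Fin m) (Fin n) ℝ) : ℝ := ∑ i, ∑ j, C i j * π i j

/-- `KL(π | γ) = Σ_{i,j} (π_{ij} log(π_{ij}/γ_{ij}) − π_{ij} + γ_{ij})` (with `0 log 0 = 0`). -/
def KLdiv {m n : ℕ} (π γ : Matrix (Fin m) (Fin n) ℝ) : ℝ :=
  ∑ i, ∑ j, (π i j * Real.log (π i j / γ i j) - π i j + γ i j)

/-- `C̃_{ij} = ‖x_i − y_j‖_p^p − |t_i − s_j|^p`. -/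
def tildeC {d m n : ℕ} (p : ℝ) (x : Fin m → Fin d → ℝ) (t : Fin m → ℝ)
    (y : Fin n → Fin d → ℝ) (s : Fin n → ℝ) : Matrix (Fin m) (Fin n) ℝ :=
  fun i j => (∑ l, |x i l - y j l| ^ p) - |t i - s j| ^ p

/-- Entrywise sup norm of a matrix. -/
def matSup {m n : ℕ} (C : Matrix (Fin m) (Fin n) ℝ) : ℝ := ⨆ i, ⨆ j, |C i j|

/-- `‖C‖_∞ = max{‖C(0)‖_∞, ‖C(1)‖_∞}`. -/
def CsupNorm {d m n : ℕ} (p : ℝ) (x : Fin m → Fin d → ℝ) (t : Fin m → ℝ)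
    (y : Fin n → Fin d → ℝ) (s : Fin n → ℝ) : ℝ :=
  max (matSup (costM p x t y s 0)) (matSup (costM p x t y s 1))

/-- The dual entropic TiOT objective
`F(u,v,w) = −u^⊤a − v^⊤b + ε Σ_{i,j} exp((u_i + v_j − C(w)_{ij})/ε) a_i b_j − ε`. -/
def Fobj {d m n : ℕ} (p ε : ℝ) (a : Fin m → ℝ) (b : Fin n → ℝ)
    (x : Fin m → Fin d → ℝ) (t : Fin m → ℝ) (y : Fin n → Fin d → ℝ) (s : Fin n → ℝ)
    (u : Fin m → ℝ) (v : Fin n → ℝ) (w : ℝ) : ℝ :=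
  -(∑ i, u i * a i) - (∑ j, v j * b j) +
    ε * (∑ i, ∑ j, Real.exp ((u i + v j - costM p x t y s w i j) / ε) * (a i * b j)) - ε

/-- `∇_w F(u,v,w) = −Σ_{i,j} C̃_{ij} exp((u_i + v_j − C(w)_{ij})/ε) a_i b_j`. -/
def gradW {d m n : ℕ} (p ε : ℝ) (a : Fin m → ℝ) (b : Fin n → ℝ)
    (x : Fin m → Fin d → ℝ) (t : Fin m → ℝ) (y : Fin n → Fin d → ℝ) (s : Fin n → ℝ)
    (u : Fin m → ℝ) (v : Fin n → ℝ) (w : ℝ) : ℝ :=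
  -(∑ i, ∑ j, tildeC p x t y s i j *
      Real.exp ((u i + v j - costM p x t y s w i j) / ε) * (a i * b j))

/-- The HBCD iteration with stepsize `η`: exact minimization in the `u` and `v` blocks
(with the normalization `a^⊤ u^{k+1} = 0`), and one projected gradient step in `w`. -/
def HBCDseq {d m n : ℕ} (p ε η : ℝ) (a : Fin m → ℝ) (b : Fin n → ℝ)
    (x : Fin m → Fin d → ℝ) (t : Fin m → ℝ) (y : Fin n → Fin d → ℝ) (s : Fin n → ℝ)
    (u : ℕ → Fin m → ℝ) (v : ℕ → Fin n → ℝ) (w : ℕ → ℝ) : Prop :=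
  ∀ k : ℕ,
    u (k + 1) = (fun i =>
      -ε * Real.log (∑ j, Real.exp (-costM p x t y s (w k) i j / ε) *
          (Real.exp (v k j / ε) * b j)) +
        ε * ∑ i', a i' * Real.log (∑ j, Real.exp (-costM p x t y s (w k) i' j / ε) *
          (Real.exp (v k j / ε) * b j))) ∧
    v (k + 1) = (fun j =>
      -ε * Real.log (∑ i, Real.exp (-costM p x t y s (w k) i j / ε) *
          (Real.exp (u (k + 1) i / ε) * a i))) ∧
    w (k + 1) = min 1 (max 0
      (w k - η * gradW p ε a b x t y s (u (k + 1)) (v (k + 1)) (w k)))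

/-- The feasible set `{(u,v,w) : a^⊤u = 0, w ∈ [0,1]}` of the dual entropic TiOT problem. -/
def feasSet {m n : ℕ} (a : Fin m → ℝ) : Set ((Fin m → ℝ) × (Fin n → ℝ) × ℝ) :=
  {ζ | (∑ i, a i * ζ.1 i) = 0 ∧ ζ.2.2 ∈ Set.Icc (0 : ℝ) 1}

/-- The set `S̃` of optimal solutions of the dual entropic TiOT minimization problem. -/
def optSet {d m n : ℕ} (p ε : ℝ) (a : Fin m → ℝ) (b : Fin n → ℝ)
    (x : Fin m → Fin d → ℝ) (t : Fin m → ℝ) (y : Fin n → Fin d → ℝ) (s : Fin n → ℝ) :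
    Set ((Fin m → ℝ) × (Fin n → ℝ) × ℝ) :=
  {ζ | ζ ∈ feasSet a ∧ ∀ ζ' ∈ feasSet (n := n) a,
    Fobj p ε a b x t y s ζ.1 ζ.2.1 ζ.2.2 ≤ Fobj p ε a b x t y s ζ'.1 ζ'.2.1 ζ'.2.2}

/-- The optimal value `F*` of the dual entropic TiOT problem. -/
def Fstar {d m n : ℕ} (p ε : ℝ) (a : Fin m → ℝ) (b : Fin n → ℝ)
    (x : Fin m → Fin d → ℝ) (t : Fin m → ℝ) (y : Fin n → Fin d → ℝ) (s : Fin n → ℝ) : ℝ :=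
  sInf {r : ℝ | ∃ ζ : (Fin m → ℝ) × (Fin n → ℝ) × ℝ, ζ ∈ feasSet a ∧
    r = Fobj p ε a b x t y s ζ.1 ζ.2.1 ζ.2.2}

/-- Euclidean (`ℓ²`) distance on `(Fin m → ℝ) × (Fin n → ℝ) × ℝ`. -/
def dist2 {m n : ℕ} (ζ ζ' : (Fin m → ℝ) × (Fin n → ℝ) × ℝ) : ℝ :=
  Real.sqrt ((∑ i, (ζ.1 i - ζ'.1 i) ^ 2) + (∑ j, (ζ.2.1 j - ζ'.2.1 j) ^ 2) +
    (ζ.2.2 - ζ'.2.2) ^ 2)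

/-! ### Scalar inequalities -/

lemma hb_exp_quad_nonneg (z : ℝ) (hz : 0 ≤ z) :
    Real.exp z ≤ 1 + z + z ^ 2 / 2 * Real.exp z := by
  have hd : ∀ y : ℝ, HasDerivAt (fun z : ℝ => 1 + z + z ^ 2 / 2 * Real.exp z - Real.exp z)
      (1 + (y * Real.exp y + y ^ 2 / 2 * Real.exp y) - Real.exp y) y := by
    intro y
    have h1 : HasDerivAt (fun z : ℝ => z ^ 2 / 2) y y := by
      have := ((hasDerivAt_id y).pow 2).div_const 2
      simpa using this
    have h2 := h1.mul (Real.hasDerivAt_exp y)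
    have h3 := (((hasDerivAt_id y).const_add 1).add h2).sub (Real.hasDerivAt_exp y)
    exact h3
  have hm : MonotoneOn (fun z : ℝ => 1 + z + z ^ 2 / 2 * Real.exp z - Real.exp z) (Set.Ici 0) := by
    apply monotoneOn_of_deriv_nonneg (convex_Ici 0)
    · exact fun y _ => (hd y).continuousAt.continuousWithinAt
    · exact fun y _ => (hd y).differentiableAt.differentiableWithinAt
    · intro y hy
      rw [(hd y).deriv]
      have h1 : -y + 1 ≤ Real.exp (-y) := Real.add_one_le_exp (-y)
      have h2 : Real.exp (-y) * Real.exp y = 1 := by rw [← Real.exp_add]; simp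
      have h3 := Real.exp_pos y
      have h4 : (-y + 1) * Real.exp y ≤ 1 := by
        exact (mul_le_mul_of_nonneg_right h1 h3.le).trans_eq h2
      have h5 : 0 ≤ y ^ 2 / 2 * Real.exp y := by positivity
      nlinarith
  have := hm (Set.mem_Ici.2 le_rfl) (Set.mem_Ici.2 hz) hz
  simp at this
  linarith

lemma hb_exp_quad (z : ℝ) : Real.exp z ≤ 1 + z + z ^ 2 / 2 * Real.exp |z| := by
  rcases le_total 0 z with hz | hz
  · rw [abs_of_nonneg hz]; exact hb_exp_quad_nonneg z hz
  · have h1 := Real.quadratic_le_exp_of_nonneg (x := -z) (by linarith)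
    have h2 : Real.exp (-z) * Real.exp z = 1 := by rw [← Real.exp_add]; simp
    have h3 := Real.exp_pos z
    have h4 : (1 + (-z) + (-z) ^ 2 / 2) * Real.exp z ≤ 1 := by
      exact (mul_le_mul_of_nonneg_right h1 h3.le).trans_eq h2
    have h5 : 1 ≤ Real.exp |z| := Real.one_le_exp (abs_nonneg z)
    have h6 : Real.exp z ≤ 1 + z + z ^ 2 / 2 := by
      have hp : 0 < 1 + (-z) + (-z) ^ 2 / 2 := by nlinarith
      have : (1 + (-z) + (-z) ^ 2 / 2) * Real.exp z
          ≤ (1 + (-z) + (-z) ^ 2 / 2) * (1 + z + z ^ 2 / 2) := by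
        refine h4.trans ?_
        nlinarith [sq_nonneg (z ^ 2)]
      exact le_of_mul_le_mul_left this hp
    nlinarith [sq_nonneg z]

lemma hb_abs_exp_sub_one (z : ℝ) : |Real.exp z - 1| ≤ |z| * Real.exp |z| := by
  rcases le_total 0 z with hz | hz
  · have h1 : 1 ≤ Real.exp z := Real.one_le_exp hz
    rw [abs_of_nonneg hz, abs_of_nonneg (by linarith)]
    have h2 : -z + 1 ≤ Real.exp (-z) := Real.add_one_le_exp (-z)
    have h3 : Real.exp (-z) * Real.exp z = 1 := by rw [← Real.exp_add]; simp
    nlinarith [Real.exp_pos z]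
  · have h1 : Real.exp z ≤ 1 := Real.exp_le_one_iff.2 hz
    have h2 := Real.add_one_le_exp z
    have h3 : 1 ≤ Real.exp |z| := Real.one_le_exp (abs_nonneg z)
    rw [abs_of_nonpos (by linarith)]
    rw [abs_of_nonpos hz] at h3 ⊢
    nlinarith

/-- A weak form of the Pinsker inequality. -/
lemma hb_pinsker {n : ℕ} (b q : Fin n → ℝ) (hb : ∀ j, 0 < b j) (hb1 : ∑ j, b j = 1)
    (hq : ∀ j, 0 < q j) (hq1 : ∑ j, b j * q j = 1) :
    (∑ j, b j * |q j - 1|) ^ 2 / 4 ≤ -∑ j, b j * Real.log (q j) := by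
  set r : Fin n → ℝ := fun j => Real.sqrt (q j) with hr
  have hrpos : ∀ j, 0 < r j := fun j => Real.sqrt_pos.2 (hq j)
  have hrr : ∀ j, r j ^ 2 = q j := fun j => Real.sq_sqrt (hq j).le
  have hsum : ∑ j, b j * r j ^ 2 = 1 := by simp only [hrr]; exact hq1
  have hX : ∑ j, b j * (1 - r j) ^ 2 ≤ -∑ j, b j * Real.log (q j) := by
    have e1 : ∑ j, b j * (1 - r j) ^ 2 = ∑ j, b j * (2 - 2 * r j) := by
      have : ∑ j, b j * (1 - r j) ^ 2 - ∑ j, b j * (2 - 2 * r j)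
          = ∑ j, b j * r j ^ 2 - ∑ j, b j := by
        rw [← Finset.sum_sub_distrib, ← Finset.sum_sub_distrib]
        exact Finset.sum_congr rfl fun j _ => by ring
      rw [hsum, hb1] at this; linarith
    rw [e1, ← Finset.sum_neg_distrib]
    refine Finset.sum_le_sum fun j _ => ?_
    have h1 := Real.log_le_sub_one_of_pos (hrpos j)
    have h2 : Real.log (q j) = 2 * Real.log (r j) := by
      rw [← hrr j, Real.log_pow]; norm_num
    rw [h2]
    nlinarith [hb j]
  have hCS : (∑ j, b j * |q j - 1|) ^ 2 ≤
      (∑ j, b j * (1 - r j) ^ 2) * ∑ j, b j * (1 + r j) ^ 2 := by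
    apply Finset.sum_sq_le_sum_mul_sum_of_sq_le_mul
    · intro j _; have := hb j; positivity
    · intro j _; have := hb j; positivity
    · intro j _
      refine le_of_eq ?_
      rw [mul_pow, sq_abs, ← hrr j]; ring
  have hY : ∑ j, b j * (1 + r j) ^ 2 ≤ 4 := by
    have : ∑ j, b j * (1 + r j) ^ 2 ≤ ∑ j, (2 * b j + 2 * (b j * r j ^ 2)) := by
      refine Finset.sum_le_sum fun j _ => ?_
      nlinarith [hb j, mul_nonneg (hb j).le (sq_nonneg (1 - r j))]
    rw [Finset.sum_add_distrib, ← Finset.mul_sum, ← Finset.mul_sum, hsum, hb1] at this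
    linarith
  have hX0 : 0 ≤ ∑ j, b j * (1 - r j) ^ 2 :=
    Finset.sum_nonneg fun j _ => mul_nonneg (hb j).le (sq_nonneg _)
  nlinarith

/-! ### The objective for a fixed cost matrix -/

/-- The objective as a function of the cost matrix. -/
def hbPhi {m n : ℕ} (ε : ℝ) (a : Fin m → ℝ) (b : Fin n → ℝ) (u : Fin m → ℝ) (v : Fin n → ℝ)
    (c : Matrix (Fin m) (Fin n) ℝ) : ℝ :=
  -(∑ i, u i * a i) - (∑ j, v j * b j) +
    ε * (∑ i, ∑ j, Real.exp ((u i + v j - c i j) / ε) * (a i * b j)) - ε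

/-- The `u`-step. -/
def hbU {m n : ℕ} (ε : ℝ) (a : Fin m → ℝ) (b : Fin n → ℝ)
    (c : Matrix (Fin m) (Fin n) ℝ) (v : Fin n → ℝ) : Fin m → ℝ := fun i =>
  -ε * Real.log (∑ j, Real.exp (-c i j / ε) * (Real.exp (v j / ε) * b j)) +
    ε * ∑ i', a i' * Real.log (∑ j, Real.exp (-c i' j / ε) * (Real.exp (v j / ε) * b j))

/-- The `v`-step. -/
def hbV {m n : ℕ} (ε : ℝ) (a : Fin m → ℝ)
    (c : Matrix (Fin m) (Fin n) ℝ) (u : Fin m → ℝ) : Fin n → ℝ := fun j =>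
  -ε * Real.log (∑ i, Real.exp (-c i j / ε) * (Real.exp (u i / ε) * a i))

lemma hb_convex {m n : ℕ} (ε : ℝ) (hε : 0 < ε) (a : Fin m → ℝ) (b : Fin n → ℝ)
    (ha : ∀ i, 0 < a i) (hb : ∀ j, 0 < b j)
    (u u' : Fin m → ℝ) (v v' : Fin n → ℝ) (c c' : Matrix (Fin m) (Fin n) ℝ) :
    hbPhi ε a b u v c - hbPhi ε a b u' v' c' ≤
      (∑ i, a i * ((∑ j, Real.exp ((u i + v j - c i j) / ε) * b j) - 1) * (u i - u' i)) +
      (∑ j, b j * ((∑ i, Real.exp ((u i + v j - c i j) / ε) * a i) - 1) * (v j - v' j)) -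
      ∑ i, ∑ j, Real.exp ((u i + v j - c i j) / ε) * (a i * b j) * (c i j - c' i j) := by
  have key : ∑ i, ∑ j, (ε * (Real.exp ((u i + v j - c i j) / ε) * (a i * b j)) -
        ε * (Real.exp ((u' i + v' j - c' i j) / ε) * (a i * b j))) ≤
      ∑ i, ∑ j, (Real.exp ((u i + v j - c i j) / ε) * (a i * b j) * (u i - u' i) +
        Real.exp ((u i + v j - c i j) / ε) * (a i * b j) * (v j - v' j) -
        Real.exp ((u i + v j - c i j) / ε) * (a i * b j) * (c i j - c' i j)) := by
    refine Finset.sum_le_sum fun i _ => Finset.sum_le_sum fun j _ => ?_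
    set z := (u i + v j - c i j) / ε with hz
    set z' := (u' i + v' j - c' i j) / ε with hz'
    have h1 : Real.exp z * (z' - z + 1) ≤ Real.exp z' := by
      have := mul_le_mul_of_nonneg_left (Real.add_one_le_exp (z' - z)) (Real.exp_pos z).le
      rwa [← Real.exp_add, add_sub_cancel] at this
    have h2 : (u i - u' i) + (v j - v' j) - (c i j - c' i j) = ε * (z - z') := by
      rw [hz, hz']; field_simp; ring
    have hab : 0 < ε * (a i * b j) := mul_pos hε (mul_pos (ha i) (hb j))
    have h3 := mul_le_mul_of_nonneg_left h1 hab.le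
    have h4 : Real.exp z * (a i * b j) * (u i - u' i) + Real.exp z * (a i * b j) * (v j - v' j) -
        Real.exp z * (a i * b j) * (c i j - c' i j) = Real.exp z * (a i * b j) * (ε * (z - z')) := by
      rw [← h2]; ring
    rw [h4]; nlinarith
  simp only [Finset.sum_sub_distrib, Finset.sum_add_distrib, ← Finset.mul_sum] at key
  have e1 : ∑ i, a i * ((∑ j, Real.exp ((u i + v j - c i j) / ε) * b j) - 1) * (u i - u' i)
      = ∑ i, ∑ j, Real.exp ((u i + v j - c i j) / ε) * (a i * b j) * (u i - u' i)
        - (∑ i, u i * a i) + ∑ i, u' i * a i := by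
    rw [← Finset.sum_sub_distrib, ← Finset.sum_add_distrib]
    refine Finset.sum_congr rfl fun i _ => ?_
    have : ∑ j, Real.exp ((u i + v j - c i j) / ε) * (a i * b j) * (u i - u' i)
        = (∑ j, Real.exp ((u i + v j - c i j) / ε) * b j) * (a i * (u i - u' i)) := by
      rw [Finset.sum_mul]; exact Finset.sum_congr rfl fun j _ => by ring
    rw [this]; ring
  have e2 : ∑ j, b j * ((∑ i, Real.exp ((u i + v j - c i j) / ε) * a i) - 1) * (v j - v' j)
      = ∑ i, ∑ j, Real.exp ((u i + v j - c i j) / ε) * (a i * b j) * (v j - v' j)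
        - (∑ j, v j * b j) + ∑ j, v' j * b j := by
    rw [Finset.sum_comm (f := fun i j =>
      Real.exp ((u i + v j - c i j) / ε) * (a i * b j) * (v j - v' j))]
    rw [← Finset.sum_sub_distrib, ← Finset.sum_add_distrib]
    refine Finset.sum_congr rfl fun j _ => ?_
    have : ∑ i, Real.exp ((u i + v j - c i j) / ε) * (a i * b j) * (v j - v' j)
        = (∑ i, Real.exp ((u i + v j - c i j) / ε) * a i) * (b j * (v j - v' j)) := by
      rw [Finset.sum_mul]; exact Finset.sum_congr rfl fun i _ => by ring
    rw [this]; ring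
  rw [e1, e2]
  unfold hbPhi
  linarith

lemma hb_exp_split (ε u v c : ℝ) :
    Real.exp (-c / ε) * Real.exp (v / ε) * Real.exp (u / ε) = Real.exp ((u + v - c) / ε) := by
  rw [← Real.exp_add, ← Real.exp_add]; congr 1; ring

lemma hbU_center {m n : ℕ} (ε : ℝ) (a : Fin m → ℝ) (b : Fin n → ℝ) (ha1 : ∑ i, a i = 1)
    (c : Matrix (Fin m) (Fin n) ℝ) (v : Fin n → ℝ) : ∑ i, a i * hbU ε a b c v i = 0 := by
  unfold hbU
  simp only [mul_add, Finset.sum_add_distrib]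
  rw [← Finset.sum_mul, ha1, one_mul, Finset.mul_sum, ← Finset.sum_add_distrib]
  exact Finset.sum_eq_zero fun i _ => by ring

lemma hbS_pos {m n : ℕ} (ε : ℝ) (hn : 1 ≤ n) (b : Fin n → ℝ) (hb : ∀ j, 0 < b j)
    (c : Matrix (Fin m) (Fin n) ℝ) (v : Fin n → ℝ) (i : Fin m) :
    0 < ∑ j, Real.exp (-c i j / ε) * (Real.exp (v j / ε) * b j) := by
  have : Nonempty (Fin n) := ⟨⟨0, hn⟩⟩
  refine Finset.sum_pos (fun j _ => ?_) Finset.univ_nonempty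
  have := hb j
  positivity

lemma hbR_pos {m n : ℕ} (ε : ℝ) (hm : 1 ≤ m) (a : Fin m → ℝ) (ha : ∀ j, 0 < a j)
    (c : Matrix (Fin m) (Fin n) ℝ) (u : Fin m → ℝ) (j : Fin n) :
    0 < ∑ i, Real.exp (-c i j / ε) * (Real.exp (u i / ε) * a i) := by
  have : Nonempty (Fin m) := ⟨⟨0, hm⟩⟩
  refine Finset.sum_pos (fun j _ => ?_) Finset.univ_nonempty
  have := ha j
  positivity

/-- After the `u`-step, some shift of `v` makes all row marginals exact. -/
lemma hbU_row {m n : ℕ} (ε : ℝ) (hε : 0 < ε) (hn : 1 ≤ n) (a : Fin m → ℝ) (b : Fin n → ℝ)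
    (hb : ∀ j, 0 < b j)
    (c : Matrix (Fin m) (Fin n) ℝ) (v : Fin n → ℝ) :
    ∃ l : ℝ, ∀ i, ∑ j, Real.exp ((hbU ε a b c v i + (v j - l) - c i j) / ε) * b j = 1 := by
  refine ⟨ε * ∑ i', a i' * Real.log (∑ j, Real.exp (-c i' j / ε) * (Real.exp (v j / ε) * b j)),
    fun i => ?_⟩
  have hS := hbS_pos ε hn b hb c v i
  unfold hbU
  set S := ∑ j, Real.exp (-c i j / ε) * (Real.exp (v j / ε) * b j) with hSd
  set l := ε * ∑ i', a i' * Real.log (∑ j, Real.exp (-c i' j / ε) * (Real.exp (v j / ε) * b j))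
  have : ∀ j, Real.exp ((-ε * Real.log S + l + (v j - l) - c i j) / ε) * b j =
      (Real.exp (-c i j / ε) * (Real.exp (v j / ε) * b j)) * S⁻¹ := by
    intro j
    have h1 : Real.exp ((-ε * Real.log S + l + (v j - l) - c i j) / ε)
        = Real.exp (-c i j / ε) * Real.exp (v j / ε) * Real.exp (-Real.log S) := by
      rw [← Real.exp_add, ← Real.exp_add]; congr 1; field_simp; ring
    rw [h1, Real.exp_neg, Real.exp_log hS]; ring
  rw [Finset.sum_congr rfl fun j _ => this j, ← Finset.sum_mul, ← hSd]
  exact mul_inv_cancel₀ (ne_of_gt hS)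

/-- After the `v`-step all column marginals are exact. -/
lemma hbV_col {m n : ℕ} (ε : ℝ) (hε : 0 < ε) (hm : 1 ≤ m) (a : Fin m → ℝ)
    (ha : ∀ j, 0 < a j)
    (c : Matrix (Fin m) (Fin n) ℝ) (u : Fin m → ℝ) (j : Fin n) :
    ∑ i, Real.exp ((u i + hbV ε a c u j - c i j) / ε) * a i = 1 := by
  have hS := hbR_pos ε hm a ha c u j
  unfold hbV
  set S := ∑ i, Real.exp (-c i j / ε) * (Real.exp (u i / ε) * a i) with hSd
  have : ∀ i, Real.exp ((u i + -ε * Real.log S - c i j) / ε) * a i =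
      (Real.exp (-c i j / ε) * (Real.exp (u i / ε) * a i)) * S⁻¹ := by
    intro i
    have h1 : Real.exp ((u i + -ε * Real.log S - c i j) / ε)
        = Real.exp (-c i j / ε) * Real.exp (u i / ε) * Real.exp (-Real.log S) := by
      rw [← Real.exp_add, ← Real.exp_add]; congr 1; field_simp; ring
    rw [h1, Real.exp_neg, Real.exp_log hS]; ring
  rw [Finset.sum_congr rfl fun j _ => this j, ← Finset.sum_mul, ← hSd]
  exact mul_inv_cancel₀ (ne_of_gt hS)

lemma hbU_bound {m n : ℕ} (ε : ℝ) (hε : 0 < ε) (hn : 1 ≤ n) (a : Fin m → ℝ) (b : Fin n → ℝ)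
    (ha : ∀ i, 0 < a i) (ha1 : ∑ i, a i = 1) (hb : ∀ j, 0 < b j) (M : ℝ)
    (c : Matrix (Fin m) (Fin n) ℝ) (hc0 : ∀ i j, 0 ≤ c i j) (hcM : ∀ i j, c i j ≤ M)
    (v : Fin n → ℝ) (i : Fin m) : |hbU ε a b c v i| ≤ M := by
  have osc : ∀ i i', hbU ε a b c v i - hbU ε a b c v i' ≤ M := by
    intro i i'
    have hS := hbS_pos ε hn b hb c v i
    have hS' := hbS_pos ε hn b hb c v i'
    have hle : ∑ j, Real.exp (-c i' j / ε) * (Real.exp (v j / ε) * b j) ≤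
        Real.exp (M / ε) * ∑ j, Real.exp (-c i j / ε) * (Real.exp (v j / ε) * b j) := by
      rw [Finset.mul_sum]
      refine Finset.sum_le_sum fun j _ => ?_
      rw [← mul_assoc (Real.exp (M / ε)), ← Real.exp_add]
      refine mul_le_mul_of_nonneg_right (Real.exp_le_exp.2 ?_)
        (mul_nonneg (Real.exp_pos _).le (hb j).le)
      rw [← add_div]
      exact div_le_div_of_nonneg_right (by linarith [hc0 i' j, hcM i j]) hε.le
    have hlog := Real.log_le_log hS' hle
    rw [Real.log_mul (Real.exp_pos _).ne' hS.ne', Real.log_exp] at hlog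
    have := mul_le_mul_of_nonneg_left hlog hε.le
    rw [mul_add, mul_div_cancel₀ _ hε.ne'] at this
    unfold hbU
    linarith
  have hcen := hbU_center ε a b ha1 c v
  have e : ∀ i, hbU ε a b c v i = ∑ i', a i' * (hbU ε a b c v i - hbU ε a b c v i') := by
    intro i
    simp only [mul_sub, Finset.sum_sub_distrib]
    rw [hcen, ← Finset.sum_mul, ha1]; ring
  have eM : M = ∑ i', a i' * M := by rw [← Finset.sum_mul, ha1, one_mul]
  rw [abs_le]
  constructor
  · rw [e i, eM, ← Finset.sum_neg_distrib]
    refine Finset.sum_le_sum fun i' _ => ?_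
    nlinarith [osc i' i, ha i']
  · rw [e i, eM]
    exact Finset.sum_le_sum fun i' _ => mul_le_mul_of_nonneg_left (osc i i') (ha i').le

lemma hbV_bound {m n : ℕ} (ε : ℝ) (hε : 0 < ε) (hm : 1 ≤ m) (a : Fin m → ℝ)
    (ha : ∀ i, 0 < a i) (ha1 : ∑ i, a i = 1) (M : ℝ) (hM : 0 ≤ M)
    (c : Matrix (Fin m) (Fin n) ℝ) (hc0 : ∀ i j, 0 ≤ c i j) (hcM : ∀ i j, c i j ≤ M)
    (u : Fin m → ℝ) (hu : ∀ i, |u i| ≤ M) (j : Fin n) : |hbV ε a c u j| ≤ 2 * M := by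
  have hR := hbR_pos ε hm a ha c u j
  have h1 : ∑ i, Real.exp (-c i j / ε) * (Real.exp (u i / ε) * a i) ≤ Real.exp (2 * M / ε) := by
    have : Real.exp (2 * M / ε) = ∑ i, Real.exp (2 * M / ε) * a i := by
      rw [← Finset.mul_sum, ha1, mul_one]
    rw [this]
    refine Finset.sum_le_sum fun i _ => ?_
    rw [← mul_assoc, ← Real.exp_add, ← add_div]
    refine mul_le_mul_of_nonneg_right (Real.exp_le_exp.2 ?_) (ha i).le
    exact div_le_div_of_nonneg_right (by linarith [hc0 i j, (abs_le.1 (hu i)).2]) hε.le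
  have h2 : Real.exp (-(2 * M / ε)) ≤
      ∑ i, Real.exp (-c i j / ε) * (Real.exp (u i / ε) * a i) := by
    have : Real.exp (-(2 * M / ε)) = ∑ i, Real.exp (-(2 * M / ε)) * a i := by
      rw [← Finset.mul_sum, ha1, mul_one]
    rw [this]
    refine Finset.sum_le_sum fun i _ => ?_
    rw [← mul_assoc, ← Real.exp_add, ← add_div, ← neg_div]
    refine mul_le_mul_of_nonneg_right (Real.exp_le_exp.2 ?_) (ha i).le
    exact div_le_div_of_nonneg_right (by linarith [hcM i j, (abs_le.1 (hu i)).1]) hε.le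
  have g1 := Real.log_le_log hR h1
  have g2 := Real.log_le_log (Real.exp_pos _) h2
  rw [Real.log_exp] at g1 g2
  have k1 := mul_le_mul_of_nonneg_left g1 hε.le
  have k2 := mul_le_mul_of_nonneg_left g2 hε.le
  have e1 : ε * (2 * M / ε) = 2 * M := mul_div_cancel₀ _ hε.ne'
  rw [mul_neg] at k2
  rw [e1] at k1 k2
  unfold hbV
  rw [abs_le]
  constructor <;> linarith

/-- Shift invariance. -/
lemma hb_shift {m n : ℕ} (ε : ℝ) (a : Fin m → ℝ) (b : Fin n → ℝ) (ha1 : ∑ i, a i = 1)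
    (hb1 : ∑ j, b j = 1) (u : Fin m → ℝ) (v : Fin n → ℝ) (c : Matrix (Fin m) (Fin n) ℝ) (l : ℝ) :
    hbPhi ε a b (fun i => u i + l) (fun j => v j - l) c = hbPhi ε a b u v c := by
  unfold hbPhi
  have e1 : ∑ i, (u i + l) * a i = ∑ i, u i * a i + l := by
    simp only [add_mul, Finset.sum_add_distrib]; rw [← Finset.mul_sum, ha1, mul_one]
  have e2 : ∑ i, (v i - l) * b i = ∑ i, v i * b i - l := by
    simp only [sub_mul, Finset.sum_sub_distrib]; rw [← Finset.mul_sum, hb1, mul_one]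
  rw [e1, e2]
  have e3 : ∀ i j, u i + l + (v j - l) - c i j = u i + v j - c i j := fun i j => by ring
  simp only [e3]
  ring

/-- A row-exact point minimizes over `u` (up to shift). -/
lemma hb_row_min {m n : ℕ} (ε : ℝ) (hε : 0 < ε) (a : Fin m → ℝ) (b : Fin n → ℝ)
    (ha : ∀ i, 0 < a i) (ha1 : ∑ i, a i = 1) (hb : ∀ j, 0 < b j) (hb1 : ∑ j, b j = 1)
    (c : Matrix (Fin m) (Fin n) ℝ) (u : Fin m → ℝ) (v : Fin n → ℝ) (l : ℝ)
    (hrow : ∀ i, ∑ j, Real.exp ((u i + (v j - l) - c i j) / ε) * b j = 1) (u' : Fin m → ℝ) :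
    hbPhi ε a b u (fun j => v j - l) c ≤ hbPhi ε a b u' v c := by
  rw [← hb_shift ε a b ha1 hb1 u' v c l]
  have h := hb_convex ε hε a b ha hb u (fun i => u' i + l) (fun j => v j - l)
    (fun j => v j - l) c c
  simp only [hrow, sub_self, mul_zero, zero_mul, Finset.sum_const_zero, add_zero] at h
  linarith

/-- Decrease of the `v`-step, starting from a row-exact point. -/
lemma hb_vstep {m n : ℕ} (ε : ℝ) (hε : 0 < ε) (hm : 1 ≤ m) (a : Fin m → ℝ) (b : Fin n → ℝ)
    (ha : ∀ i, 0 < a i) (ha1 : ∑ i, a i = 1) (hb : ∀ j, 0 < b j) (hb1 : ∑ j, b j = 1)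
    (c : Matrix (Fin m) (Fin n) ℝ) (u : Fin m → ℝ) (v : Fin n → ℝ)
    (hrow : ∀ i, ∑ j, Real.exp ((u i + v j - c i j) / ε) * b j = 1) :
    ∃ q : Fin n → ℝ, (∀ j, 0 < q j) ∧ (∑ j, b j * q j = 1) ∧
      (∀ j, ∑ i, Real.exp ((u i + v j - c i j) / ε) * a i = q j) ∧
      (∀ i j, Real.exp ((u i + v j - c i j) / ε) =
        q j * Real.exp ((u i + hbV ε a c u j - c i j) / ε)) ∧
      ε * (∑ j, b j * |q j - 1|) ^ 2 / 4 ≤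
        hbPhi ε a b u v c - hbPhi ε a b u (hbV ε a c u) c := by
  have hR := hbR_pos ε hm a ha c u
  set R : Fin n → ℝ := fun j => ∑ i, Real.exp (-c i j / ε) * (Real.exp (u i / ε) * a i) with hRd
  set q : Fin n → ℝ := fun j => ∑ i, Real.exp ((u i + v j - c i j) / ε) * a i with hqd
  have hqR : ∀ j, q j = Real.exp (v j / ε) * R j := by
    intro j
    simp only [hqd, hRd]
    rw [Finset.mul_sum]
    refine Finset.sum_congr rfl fun i _ => ?_
    rw [← hb_exp_split]; ring
  have hqpos : ∀ j, 0 < q j := fun j => by rw [hqR]; exact mul_pos (Real.exp_pos _) (hR j)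
  have hVq : ∀ j, hbV ε a c u j = v j - ε * Real.log (q j) := by
    intro j
    rw [hqR, Real.log_mul (Real.exp_pos _).ne' (hR j).ne', Real.log_exp]
    unfold hbV
    rw [mul_add, mul_div_cancel₀ _ hε.ne']; ring
  have hmass : ∑ i, ∑ j, Real.exp ((u i + v j - c i j) / ε) * (a i * b j) = 1 := by
    rw [← ha1]
    refine Finset.sum_congr rfl fun i _ => ?_
    calc _ = (∑ j, Real.exp ((u i + v j - c i j) / ε) * b j) * a i := by
          rw [Finset.sum_mul]; exact Finset.sum_congr rfl fun j _ => by ring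
      _ = a i := by rw [hrow, one_mul]
  have hq1 : ∑ j, b j * q j = 1 := by
    rw [← hmass, Finset.sum_comm]
    refine Finset.sum_congr rfl fun j _ => ?_
    simp only [hqd]
    rw [Finset.mul_sum]
    exact Finset.sum_congr rfl fun i _ => by ring
  have hmass' : ∑ i, ∑ j, Real.exp ((u i + hbV ε a c u j - c i j) / ε) * (a i * b j) = 1 := by
    rw [← hb1, Finset.sum_comm]
    refine Finset.sum_congr rfl fun j _ => ?_
    have := hbV_col ε hε hm a ha c u j
    calc _ = (∑ i, Real.exp ((u i + hbV ε a c u j - c i j) / ε) * a i) * b j := by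
          rw [Finset.sum_mul]; exact Finset.sum_congr rfl fun i _ => by ring
      _ = b j := by rw [this, one_mul]
  refine ⟨q, hqpos, hq1, fun j => rfl, ?_, ?_⟩
  · intro i j
    conv_rhs => rw [← Real.exp_log (hqpos j)]
    rw [← Real.exp_add]
    congr 1
    rw [hVq]
    field_simp
    ring
  · have hp := hb_pinsker b q hb hb1 hqpos hq1
    unfold hbPhi
    rw [hmass, hmass']
    have e : ∑ j, hbV ε a c u j * b j = ∑ j, v j * b j - ε * ∑ j, b j * Real.log (q j) := by
      rw [Finset.mul_sum, ← Finset.sum_sub_distrib]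
      refine Finset.sum_congr rfl fun j _ => ?_
      rw [hVq]; ring
    rw [e]
    have := mul_le_mul_of_nonneg_left hp hε.le
    linarith

lemma hb_mass {m n : ℕ} (ε : ℝ) (a : Fin m → ℝ) (b : Fin n → ℝ) (hb1 : ∑ j, b j = 1)
    (c : Matrix (Fin m) (Fin n) ℝ) (u : Fin m → ℝ) (v : Fin n → ℝ)
    (hcol : ∀ j, ∑ i, Real.exp ((u i + v j - c i j) / ε) * a i = 1) :
    ∑ i, ∑ j, Real.exp ((u i + v j - c i j) / ε) * (a i * b j) = 1 := by
  rw [← hb1, Finset.sum_comm]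
  refine Finset.sum_congr rfl fun j _ => ?_
  calc _ = (∑ i, Real.exp ((u i + v j - c i j) / ε) * a i) * b j := by
        rw [Finset.sum_mul]; exact Finset.sum_congr rfl fun i _ => by ring
    _ = b j := by rw [hcol, one_mul]

/-- Smoothness in `w`. -/
lemma hb_wsmooth {m n : ℕ} (ε : ℝ) (hε : 0 < ε) (a : Fin m → ℝ) (b : Fin n → ℝ)
    (ha : ∀ i, 0 < a i) (hb : ∀ j, 0 < b j)
    (c c' T : Matrix (Fin m) (Fin n) ℝ) (u : Fin m → ℝ) (v : Fin n → ℝ)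
    (hmass : ∑ i, ∑ j, Real.exp ((u i + v j - c i j) / ε) * (a i * b j) = 1)
    (K M h : ℝ) (hT : ∀ i j, |T i j| ≤ K) (hK : 0 ≤ K) (hKM : K ≤ M) (hh : |h| ≤ 1)
    (hc' : ∀ i j, c' i j = c i j + h * T i j) :
    hbPhi ε a b u v c' ≤ hbPhi ε a b u v c +
      (-(∑ i, ∑ j, T i j * Real.exp ((u i + v j - c i j) / ε) * (a i * b j))) * h +
      K ^ 2 / ε * Real.exp (6 * M / ε) / 2 * h ^ 2 := by
  have key : ∑ i, ∑ j, ε * (Real.exp ((u i + v j - c' i j) / ε) * (a i * b j)) ≤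
      ∑ i, ∑ j, (ε * (Real.exp ((u i + v j - c i j) / ε) * (a i * b j)) -
        h * (T i j * Real.exp ((u i + v j - c i j) / ε) * (a i * b j)) +
        (K ^ 2 / ε * Real.exp (6 * M / ε) / 2 * h ^ 2) *
          (Real.exp ((u i + v j - c i j) / ε) * (a i * b j))) := by
    refine Finset.sum_le_sum fun i _ => Finset.sum_le_sum fun j _ => ?_
    have hab : 0 < a i * b j := mul_pos (ha i) (hb j)
    set z := (u i + v j - c i j) / ε with hz
    set y := -(h * T i j) / ε with hy
    have e1 : (u i + v j - c' i j) / ε = z + y := by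
      rw [hz, hy, hc', ← add_div]; congr 1; ring
    have hyabs : |y| ≤ 6 * M / ε := by
      rw [hy, abs_div, abs_neg, abs_mul, abs_of_pos hε]
      refine div_le_div_of_nonneg_right ?_ hε.le
      nlinarith [hT i j, abs_nonneg (T i j), abs_nonneg h]
    have hysq : ε * (y ^ 2 / 2) ≤ K ^ 2 / ε / 2 * h ^ 2 := by
      have : ε * (y ^ 2 / 2) = (T i j) ^ 2 / ε / 2 * h ^ 2 := by
        rw [hy]; field_simp
      rw [this]
      have : (T i j) ^ 2 ≤ K ^ 2 := by
        rw [← sq_abs (T i j)]; exact pow_le_pow_left₀ (abs_nonneg _) (hT i j) 2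
      gcongr
    have hq := hb_exp_quad y
    have h1 : Real.exp |y| ≤ Real.exp (6 * M / ε) := Real.exp_le_exp.2 hyabs
    have h2 : ε * Real.exp y ≤ ε - h * T i j + K ^ 2 / ε * Real.exp (6 * M / ε) / 2 * h ^ 2 := by
      have hy' : ε * y = -(h * T i j) := by rw [hy]; field_simp
      have h3 : ε * (y ^ 2 / 2) * Real.exp |y| ≤ K ^ 2 / ε / 2 * h ^ 2 * Real.exp (6 * M / ε) :=
        mul_le_mul hysq h1 (Real.exp_pos _).le (by positivity)
      have := mul_le_mul_of_nonneg_left hq hε.le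
      nlinarith
    rw [e1, Real.exp_add]
    have := mul_le_mul_of_nonneg_left h2 (mul_pos (Real.exp_pos z) hab).le
    nlinarith
  simp only [Finset.sum_sub_distrib, Finset.sum_add_distrib, ← Finset.mul_sum] at key
  rw [hmass] at key
  unfold hbPhi
  rw [hmass]
  linarith

/-! ### One step of the method -/

lemma hb_prox (η N g w w' : ℝ) (hw' : w' ∈ Set.Icc (0 : ℝ) 1)
    (hN : 0 ≤ N) (h : η * N = 1 ∨ (g = 0 ∧ N = 0)) :
    g * (min 1 (max 0 (w - η * g)) - w') ≤
      N * ((w - min 1 (max 0 (w - η * g))) * (min 1 (max 0 (w - η * g)) - w')) := by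
  set w₁ := min 1 (max 0 (w - η * g)) with hw₁
  have h1 : (w - η * g - w₁) * (w' - w₁) ≤ 0 := by
    obtain ⟨h0, h1⟩ := hw'
    rcases le_total (w - η * g) 0 with hc | hc
    · have : w₁ = 0 := by rw [hw₁, max_eq_left hc]; norm_num
      rw [this]; nlinarith
    · rcases le_total (w - η * g) 1 with hd | hd
      · have : w₁ = w - η * g := by rw [hw₁, max_eq_right hc, min_eq_right hd]
        rw [this]; simp
      · have : w₁ = 1 := by rw [hw₁, max_eq_right hc, min_eq_left hd]
        rw [this]; nlinarith
  rcases h with h | ⟨hg, hN0⟩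
  · have h2 := mul_le_mul_of_nonneg_left h1 hN
    have h3 : N * ((w - η * g - w₁) * (w' - w₁)) =
      -(N * ((w - w₁) * (w₁ - w'))) + (η * N) * (g * (w₁ - w')) := by ring
    rw [h3, h] at h2
    linarith
  · rw [hg, hN0]; simp

lemma hb_min_mem (z : ℝ) : min 1 (max 0 z) ∈ Set.Icc (0 : ℝ) 1 :=
  ⟨le_min (by norm_num) (le_max_left _ _), min_le_left _ _⟩

lemma hb_sum_abs_le {n : ℕ} (b q d : Fin n → ℝ) (B : ℝ) (hb : ∀ j, 0 < b j)
    (hd : ∀ j, |d j| ≤ B) :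
    ∑ j, b j * q j * d j ≤ B * ∑ j, b j * |q j| := by
  rw [Finset.mul_sum]
  refine Finset.sum_le_sum fun j _ => ?_
  have h1 : q j * d j ≤ |q j| * B := by
    refine (le_abs_self _).trans ?_
    rw [abs_mul]
    exact mul_le_mul_of_nonneg_left (hd j) (abs_nonneg _)
  nlinarith [hb j]

set_option maxHeartbeats 1000000 in
lemma hb_step {m n : ℕ} (hm : 1 ≤ m) (hn : 1 ≤ n) (ε : ℝ) (hε : 0 < ε)
    (a : Fin m → ℝ) (b : Fin n → ℝ)
    (ha : ∀ i, 0 < a i) (ha1 : ∑ i, a i = 1) (hb : ∀ j, 0 < b j) (hb1 : ∑ j, b j = 1)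
    (C : ℝ → Matrix (Fin m) (Fin n) ℝ) (T : Matrix (Fin m) (Fin n) ℝ) (M K η : ℝ)
    (hC0 : ∀ w ∈ Set.Icc (0 : ℝ) 1, ∀ i j, 0 ≤ C w i j)
    (hCM : ∀ w ∈ Set.Icc (0 : ℝ) 1, ∀ i j, C w i j ≤ M)
    (hlin : ∀ w w' i j, C w' i j = C w i j + (w' - w) * T i j)
    (hT : ∀ i j, |T i j| ≤ K) (hK : 0 ≤ K) (hKM : K ≤ M)
    (hη : η = (ε / K ^ 2) * Real.exp (-(6 * M) / ε))
    (u₁ : Fin m → ℝ) (v v₁ : Fin n → ℝ) (w w₁ g : ℝ) (hw : w ∈ Set.Icc (0 : ℝ) 1)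
    (hu₁ : u₁ = hbU ε a b (C w) v) (hv₁ : v₁ = hbV ε a (C w) u₁)
    (hg : g = -(∑ i, ∑ j, T i j * Real.exp ((u₁ i + v₁ j - C w i j) / ε) * (a i * b j)))
    (hw₁ : w₁ = min 1 (max 0 (w - η * g))) :
    (∀ (u' : Fin m → ℝ) (v' : Fin n → ℝ) (w' : ℝ), (∀ i, |u' i| ≤ M) →
        w' ∈ Set.Icc (0 : ℝ) 1 →
        hbPhi ε a b u₁ v₁ (C w₁) - hbPhi ε a b u' v' (C w') ≤
          8 * (M ^ 2 / ε * Real.exp (6 * M / ε))) ∧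
    ((∀ j, |v j| ≤ 2 * M) → ∀ u₀ : Fin m → ℝ, ∃ Y : ℝ, 0 ≤ Y ∧
        0 ≤ hbPhi ε a b u₀ v (C w) - hbPhi ε a b u₁ v₁ (C w₁) ∧
        Y ^ 2 ≤ 200 * (M ^ 2 / ε * Real.exp (6 * M / ε)) *
          (hbPhi ε a b u₀ v (C w) - hbPhi ε a b u₁ v₁ (C w₁)) ∧
        ∀ (u' : Fin m → ℝ) (v' : Fin n → ℝ) (w' : ℝ), (∀ j, |v' j| ≤ 2 * M) →
          w' ∈ Set.Icc (0 : ℝ) 1 →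
          hbPhi ε a b u₁ v₁ (C w₁) - hbPhi ε a b u' v' (C w') ≤ Y) := by
  have hM : 0 ≤ M := hK.trans hKM
  have hw₁m : w₁ ∈ Set.Icc (0 : ℝ) 1 := hw₁ ▸ hb_min_mem _
  have hubd : ∀ i, |u₁ i| ≤ M := fun i => by
    rw [hu₁]; exact hbU_bound ε hε hn a b ha ha1 hb M (C w) (hC0 w hw) (hCM w hw) v i
  have hvbd : ∀ j, |v₁ j| ≤ 2 * M := fun j => by
    rw [hv₁]; exact hbV_bound ε hε hm a ha ha1 M hM (C w) (hC0 w hw) (hCM w hw) u₁ hubd j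
  have hcol : ∀ j, ∑ i, Real.exp ((u₁ i + v₁ j - C w i j) / ε) * a i = 1 := fun j => by
    rw [hv₁]; exact hbV_col ε hε hm a ha (C w) u₁ j
  have hmass := hb_mass ε a b hb1 (C w) u₁ v₁ hcol
  set E := Real.exp (6 * M / ε) with hE
  have hE1 : 1 ≤ E := Real.one_le_exp (by positivity)
  set N := K ^ 2 / ε * E with hNd
  set P := M ^ 2 / ε * E with hPd
  have hN : 0 ≤ N := by positivity
  have hP : 0 ≤ P := by positivity
  have hNP : N ≤ P := by
    rw [hNd, hPd]; gcongr
  have hMP : M ^ 2 / ε ≤ P := by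
    rw [hPd]; exact le_mul_of_one_le_right (by positivity) hE1
  have hηN : η * N = 1 ∨ (g = 0 ∧ N = 0) := by
    rcases hK.eq_or_lt with h0 | h0
    · right
      have hT0 : ∀ i j, T i j = 0 := fun i j => by
        have := hT i j; rw [← h0] at this; exact abs_nonpos_iff.1 this
      refine ⟨?_, ?_⟩
      · rw [hg]; simp [hT0]
      · rw [hNd, ← h0]; simp
    · left
      rw [hη, hNd, hE, neg_div, Real.exp_neg]
      have := Real.exp_pos (6 * M / ε)
      field_simp
  have hprox : ∀ w' ∈ Set.Icc (0 : ℝ) 1, g * (w₁ - w') ≤ N * ((w - w₁) * (w₁ - w')) := by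
    intro w' hw'
    have := hb_prox η N g w w' hw' hN hηN
    rwa [← hw₁] at this
  have hdist : ∀ y ∈ Set.Icc (0 : ℝ) 1, ∀ z ∈ Set.Icc (0 : ℝ) 1, |y - z| ≤ 1 := by
    rintro y ⟨h1, h2⟩ z ⟨h3, h4⟩
    rw [abs_le]; constructor <;> linarith
  have hsm : hbPhi ε a b u₁ v₁ (C w₁) ≤ hbPhi ε a b u₁ v₁ (C w) + g * (w₁ - w) +
      N / 2 * (w₁ - w) ^ 2 := by
    have := hb_wsmooth ε hε a b ha hb (C w) (C w₁) T u₁ v₁ hmass K M (w₁ - w) hT hK hKM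
      (hdist _ hw₁m _ hw) (fun i j => hlin w w₁ i j)
    rw [← hg] at this
    exact this
  set D := |w - w₁| with hD
  have hD0 : 0 ≤ D := abs_nonneg _
  have hD1 : D ≤ 1 := hdist _ hw _ hw₁m
  have hDsq : (w₁ - w) ^ 2 = D ^ 2 := by rw [hD, sq_abs]; ring
  rw [hDsq] at hsm
  have hprox' : ∀ w' ∈ Set.Icc (0 : ℝ) 1, g * (w₁ - w') ≤ N * D := by
    intro w' hw'
    refine (hprox w' hw').trans (mul_le_mul_of_nonneg_left ?_ hN)
    refine (le_abs_self _).trans ?_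
    rw [abs_mul]
    exact mul_le_of_le_one_right hD0 (hdist _ hw₁m _ hw')
  have hDD : D ^ 2 ≤ D := by nlinarith
  constructor
  · intro u' v' w' hu' hw'
    have hcv := hb_convex ε hε a b ha hb u₁ u' v₁ v' (C w) (C w')
    simp only [hcol, sub_self, mul_zero, zero_mul, Finset.sum_const_zero, add_zero] at hcv
    have e1 : ∑ i, ∑ j, Real.exp ((u₁ i + v₁ j - C w i j) / ε) * (a i * b j) *
        (C w i j - C w' i j) = -g * (w - w') := by
      rw [hg, neg_neg, Finset.sum_mul]
      refine Finset.sum_congr rfl fun i _ => ?_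
      rw [Finset.sum_mul]
      refine Finset.sum_congr rfl fun j _ => ?_
      rw [hlin w w' i j]; ring
    rw [e1] at hcv
    have e2 : ∑ i, a i * ((∑ j, Real.exp ((u₁ i + v₁ j - C w i j) / ε) * b j) - 1) *
        (u₁ i - u' i) ≤ 2 * M * ∑ i, a i *
          |(∑ j, Real.exp ((u₁ i + v₁ j - C w i j) / ε) * b j) - 1| := by
      refine hb_sum_abs_le a (fun i => (∑ j, Real.exp ((u₁ i + v₁ j - C w i j) / ε) * b j) - 1)
        (fun i => u₁ i - u' i) (2 * M) ha fun i => ?_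
      have h1 := abs_le.1 (hubd i)
      have h2 := abs_le.1 (hu' i)
      rw [abs_le]; constructor <;> linarith
    have e3 : ∀ i, |(∑ j, Real.exp ((u₁ i + v₁ j - C w i j) / ε) * b j) - 1| ≤
        3 * M / ε * E := by
      intro i
      have h1 : (∑ j, Real.exp ((u₁ i + v₁ j - C w i j) / ε) * b j) - 1 =
          ∑ j, (Real.exp ((u₁ i + v₁ j - C w i j) / ε) - 1) * b j := by
        simp only [sub_mul, Finset.sum_sub_distrib, one_mul, hb1]
      rw [h1]
      refine (Finset.abs_sum_le_sum_abs _ _).trans ?_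
      have h2 : 3 * M / ε * E = ∑ j, 3 * M / ε * E * b j := by
        rw [← Finset.mul_sum, hb1, mul_one]
      rw [h2]
      refine Finset.sum_le_sum fun j _ => ?_
      rw [abs_mul, abs_of_pos (hb j)]
      refine mul_le_mul_of_nonneg_right ?_ (hb j).le
      refine (hb_abs_exp_sub_one _).trans ?_
      have hz : |(u₁ i + v₁ j - C w i j) / ε| ≤ 3 * M / ε := by
        rw [abs_div, abs_of_pos hε]
        refine div_le_div_of_nonneg_right ?_ hε.le
        have h1 := abs_le.1 (hubd i)
        have h2 := abs_le.1 (hvbd j)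
        have h3 := hC0 w hw i j
        have h4 := hCM w hw i j
        have h5 : v₁ j ≥ -M := by
          by_contra hcon
          push Not at hcon
          have hlt : ∑ i, Real.exp ((u₁ i + v₁ j - C w i j) / ε) * a i < ∑ i, a i := by
            have : Nonempty (Fin m) := ⟨⟨0, hm⟩⟩
            refine Finset.sum_lt_sum_of_nonempty Finset.univ_nonempty fun i' _ => ?_
            have hneg : (u₁ i' + v₁ j - C w i' j) / ε < 0 := by
              refine div_neg_of_neg_of_pos ?_ hε
              have := (abs_le.1 (hubd i')).2
              have := hC0 w hw i' j
              linarith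
            have := Real.exp_zero ▸ Real.exp_lt_exp.2 hneg
            nlinarith [ha i']
          rw [hcol j, ha1] at hlt
          exact lt_irrefl _ hlt
        rw [abs_le]; constructor <;> linarith
      refine mul_le_mul hz (Real.exp_le_exp.2 (hz.trans ?_)) (Real.exp_pos _).le (by positivity)
      exact div_le_div_of_nonneg_right (by linarith) hε.le
    have e4 : ∑ i, a i * |(∑ j, Real.exp ((u₁ i + v₁ j - C w i j) / ε) * b j) - 1| ≤
        3 * M / ε * E := by
      have h2 : 3 * M / ε * E = ∑ i, a i * (3 * M / ε * E) := by
        rw [← Finset.sum_mul, ha1, one_mul]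
      rw [h2]
      exact Finset.sum_le_sum fun i _ => mul_le_mul_of_nonneg_left (e3 i) (ha i).le
    have e5 : 2 * M * (3 * M / ε * E) = 6 * P := by rw [hPd]; ring
    have e6 := mul_le_mul_of_nonneg_left e4 (by positivity : 0 ≤ 2 * M)
    rw [e5] at e6
    have e7 := hprox' w' hw'
    have e8 : N * D ≤ N := mul_le_of_le_one_right hN hD1
    have e9 : N * D ^ 2 ≤ N * D := mul_le_mul_of_nonneg_left hDD hN
    linarith
  · intro hvb u₀
    obtain ⟨l, hrow⟩ := hbU_row ε hε hn a b hb (C w) v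
    rw [← hu₁] at hrow
    have hmin := hb_row_min ε hε a b ha ha1 hb hb1 (C w) u₁ v l hrow u₀
    obtain ⟨q, hq0, hq1, hqcol, hqexp, hdec⟩ :=
      hb_vstep ε hε hm a b ha ha1 hb hb1 (C w) u₁ (fun j => v j - l) hrow
    rw [← hv₁] at hqexp hdec
    set δ := ∑ j, b j * |q j - 1| with hδ
    have hδ0 : 0 ≤ δ := Finset.sum_nonneg fun j _ => mul_nonneg (hb j).le (abs_nonneg _)
    have hself : g * (w₁ - w) ≤ -(N * D ^ 2) := by
      have := hprox w hw
      rw [← hDsq]; linarith [this]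
    have hDec : ε * δ ^ 2 / 4 + N * D ^ 2 / 2 ≤
        hbPhi ε a b u₀ v (C w) - hbPhi ε a b u₁ v₁ (C w₁) := by linarith
    set Q := hbPhi ε a b u₀ v (C w) - hbPhi ε a b u₁ v₁ (C w₁) with hQ
    have hQ0 : 0 ≤ Q := le_trans (by positivity) hDec
    refine ⟨5 * M * δ + 3 / 2 * N * D, by positivity, hQ0, ?_, ?_⟩
    · have h1 : (5 * M * δ + 3 / 2 * N * D) ^ 2 ≤ 50 * M ^ 2 * δ ^ 2 + 9 / 2 * N ^ 2 * D ^ 2 := by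
        linarith [sq_nonneg (5 * M * δ - 3 / 2 * N * D)]
      have h2 : 50 * M ^ 2 * δ ^ 2 = 200 * (M ^ 2 / ε) * (ε * δ ^ 2 / 4) := by
        field_simp; ring
      have h3 : 9 / 2 * N ^ 2 * D ^ 2 = 9 * N * (N * D ^ 2 / 2) := by ring
      have h4 : 200 * (M ^ 2 / ε) * (ε * δ ^ 2 / 4) ≤ 200 * P * (ε * δ ^ 2 / 4) := by
        gcongr
      have h5 : 9 * N * (N * D ^ 2 / 2) ≤ 200 * P * (N * D ^ 2 / 2) := by
        refine mul_le_mul_of_nonneg_right (by linarith) (by positivity)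
      have h6 : 200 * P * (ε * δ ^ 2 / 4 + N * D ^ 2 / 2) ≤ 200 * P * Q :=
        mul_le_mul_of_nonneg_left hDec (by positivity)
      linarith
    · intro u' v' w' hv' hw'
      have hcv := hb_convex ε hε a b ha hb u₁ u' (fun j => v j - l) v' (C w) (C w')
      simp only [hrow, hqcol, sub_self, mul_zero, zero_mul, Finset.sum_const_zero, zero_add] at hcv
      have e1 : ∑ j, b j * (q j - 1) * (v j - l - v' j) =
          ∑ j, b j * (q j - 1) * (v j - v' j) := by
        have h1 : ∑ j, b j * (q j - 1) = 0 := by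
          simp only [mul_sub, Finset.sum_sub_distrib, mul_one, hq1, hb1, sub_self]
        have h2 : ∑ j, b j * (q j - 1) * (v j - l - v' j) =
          ∑ j, b j * (q j - 1) * (v j - v' j) - (∑ j, b j * (q j - 1)) * l := by
          rw [Finset.sum_mul, ← Finset.sum_sub_distrib]
          exact Finset.sum_congr rfl fun j _ => by ring
        rw [h2, h1]; ring
      have e2 : ∑ j, b j * (q j - 1) * (v j - v' j) ≤ 4 * M * δ := by
        refine hb_sum_abs_le b (fun j => q j - 1) (fun j => v j - v' j) (4 * M) hb fun j => ?_
        have h1 := abs_le.1 (hvb j)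
        have h2 := abs_le.1 (hv' j)
        rw [abs_le]; constructor <;> linarith
      have e3 : ∑ i, ∑ j, Real.exp ((u₁ i + (v j - l) - C w i j) / ε) * (a i * b j) *
          (C w i j - C w' i j) = -g * (w - w') +
          ∑ j, b j * (q j - 1) * ((w - w') *
            ∑ i, T i j * (Real.exp ((u₁ i + v₁ j - C w i j) / ε) * a i)) := by
        rw [hg, neg_neg, Finset.sum_comm, Finset.sum_comm (f := fun i j =>
          T i j * Real.exp ((u₁ i + v₁ j - C w i j) / ε) * (a i * b j)), Finset.sum_mul,
          ← Finset.sum_add_distrib]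
        refine Finset.sum_congr rfl fun j _ => ?_
        rw [Finset.sum_mul, Finset.mul_sum, Finset.mul_sum, ← Finset.sum_add_distrib]
        refine Finset.sum_congr rfl fun i _ => ?_
        rw [hlin w w' i j, hqexp i j]; ring
      have e4 : -(K * δ) ≤ ∑ j, b j * (q j - 1) * ((w - w') *
            ∑ i, T i j * (Real.exp ((u₁ i + v₁ j - C w i j) / ε) * a i)) := by
        have := hb_sum_abs_le b (fun j => q j - 1) (fun j => -((w - w') *
            ∑ i, T i j * (Real.exp ((u₁ i + v₁ j - C w i j) / ε) * a i))) K hb (fun j => by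
          rw [abs_neg, abs_mul]
          have h1 : |∑ i, T i j * (Real.exp ((u₁ i + v₁ j - C w i j) / ε) * a i)| ≤ K := by
            refine (Finset.abs_sum_le_sum_abs _ _).trans ?_
            have h2 : K = ∑ i, K * (Real.exp ((u₁ i + v₁ j - C w i j) / ε) * a i) := by
              rw [← Finset.mul_sum, hcol, mul_one]
            rw [h2]
            refine Finset.sum_le_sum fun i _ => ?_
            have h3 : 0 ≤ Real.exp ((u₁ i + v₁ j - C w i j) / ε) * a i :=
              mul_nonneg (Real.exp_pos _).le (ha i).le
            rw [abs_mul, abs_of_nonneg h3]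
            have := mul_le_mul_of_nonneg_right (hT i j) h3
            exact this
          exact (mul_le_of_le_one_left (abs_nonneg _) (hdist _ hw _ hw')).trans h1)
        simp only [mul_neg, Finset.sum_neg_distrib] at this
        linarith
      rw [e1, e3] at hcv
      have e5 := hprox' w' hw'
      have e6 : K * δ ≤ M * δ := mul_le_mul_of_nonneg_right hKM hδ0
      have e7 : 0 ≤ ε * δ ^ 2 / 4 := by positivity
      have e9 : N * D ^ 2 ≤ N * D := mul_le_mul_of_nonneg_left hDD hN
      linarith

lemma hb_recur (A : ℕ → ℝ) (ρ : ℝ) (hρ : 0 ≤ ρ) (h1 : A 1 ≤ 2 * ρ)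
    (hA : ∀ k, 1 ≤ k → A (k + 1) ^ 2 ≤ ρ * (A k - A (k + 1))) :
    ∀ k : ℕ, 1 ≤ k → A k ≤ 2 * ρ / k := by
  intro k hk
  induction k, hk using Nat.le_induction with
  | base => simpa using h1
  | succ k hk ih =>
    have hk' : (1 : ℝ) ≤ k := by exact_mod_cast hk
    have hr := hA k hk
    by_contra hcon
    push Not at hcon
    push_cast at hcon
    rcases hρ.eq_or_lt with h0 | h0
    · rw [← h0] at hr hcon
      simp at hcon
      nlinarith [pow_pos hcon 2]
    · have hx : 0 < 2 * ρ / ((k : ℝ) + 1) := by positivity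
      have h2 : (2 * ρ / ((k : ℝ) + 1)) ^ 2 < A (k + 1) ^ 2 := by
        exact pow_lt_pow_left₀ hcon hx.le two_ne_zero
      have h3 : (2 * ρ / ((k : ℝ) + 1)) ^ 2 < ρ * (2 * ρ / k - 2 * ρ / ((k : ℝ) + 1)) := by
        refine h2.trans_le (hr.trans (mul_le_mul_of_nonneg_left (by linarith) hρ))
      have h4 : ρ * (2 * ρ / k - 2 * ρ / ((k : ℝ) + 1)) = 2 * ρ ^ 2 / (k * (k + 1)) := by
        field_simp; ring
      have h5 : (2 * ρ / ((k : ℝ) + 1)) ^ 2 = 4 * ρ ^ 2 / ((k + 1) * (k + 1)) := by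
        field_simp; ring
      rw [h4, h5, div_lt_div_iff₀ (by positivity) (by positivity)] at h3
      have h6 : 0 < ρ ^ 2 * (k + 1) := by positivity
      have h7 : ρ ^ 2 * (k + 1) * (4 * k) < ρ ^ 2 * (k + 1) * (2 * (k + 1)) := by linarith
      have h8 := lt_of_mul_lt_mul_left h7 h6.le
      linarith

lemma hb_le_matSup {m n : ℕ} (C : Matrix (Fin m) (Fin n) ℝ) (i : Fin m) (j : Fin n) :
    |C i j| ≤ matSup C := by
  unfold matSup
  refine (le_ciSup (f := fun j => |C i j|) (Set.finite_range _).bddAbove j).trans ?_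
  exact le_ciSup (f := fun i => ⨆ j, |C i j|) (Set.finite_range _).bddAbove i

lemma hb_matSup_nonneg {m n : ℕ} (C : Matrix (Fin m) (Fin n) ℝ) : 0 ≤ matSup C :=
  Real.iSup_nonneg fun _ => Real.iSup_nonneg fun _ => abs_nonneg _

lemma hb_matSup_le {m n : ℕ} (C : Matrix (Fin m) (Fin n) ℝ) (B : ℝ) (hB : 0 ≤ B)
    (h : ∀ i j, |C i j| ≤ B) : matSup C ≤ B :=
  Real.iSup_le (fun i => Real.iSup_le (fun j => h i j) hB) hB

/-- Sublinear convergence rate of HBCD with stepsize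
`η = (ε/‖C̃‖_∞²) exp(−6‖C‖_∞/ε)`: for every `k ≥ 1`, `F(ζ^k) − F* ≤ ρ₁ρ₂/k`, where
`ρ₁ = (192m + 216n + 24)(‖C‖_∞²/ε) exp(18‖C‖_∞/ε)` and
`ρ₂ = max{4/ρ₁ − 2, F(ζ¹) − F*, 2}`. -/
theorem HBCD_sublinear_rate {d m n : ℕ} (hm : 1 ≤ m) (hn : 1 ≤ n)
    (p ε η : ℝ) (hp : 1 ≤ p) (hε : 0 < ε)
    (a : Fin m → ℝ) (b : Fin n → ℝ)
    (ha : ∀ i, 0 < a i) (ha1 : ∑ i, a i = 1) (hb : ∀ j, 0 < b j) (hb1 : ∑ j, b j = 1)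
    (x : Fin m → Fin d → ℝ) (t : Fin m → ℝ) (y : Fin n → Fin d → ℝ) (s : Fin n → ℝ)
    (hη : η = (ε / matSup (tildeC p x t y s) ^ 2) *
      Real.exp (-(6 * CsupNorm p x t y s) / ε))
    (u : ℕ → Fin m → ℝ) (v : ℕ → Fin n → ℝ) (w : ℕ → ℝ)
    (hw0 : w 0 ∈ Set.Icc (0 : ℝ) 1)
    (hseq : HBCDseq p ε η a b x t y s u v w) :
    ∀ k : ℕ, 1 ≤ k →
      Fobj p ε a b x t y s (u k) (v k) (w k) - Fstar p ε a b x t y s ≤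
        ((192 * (m : ℝ) + 216 * (n : ℝ) + 24) * (CsupNorm p x t y s ^ 2 / ε) *
            Real.exp (18 * CsupNorm p x t y s / ε)) *
          max (max
            (4 / ((192 * (m : ℝ) + 216 * (n : ℝ) + 24) * (CsupNorm p x t y s ^ 2 / ε) *
              Real.exp (18 * CsupNorm p x t y s / ε)) - 2)
            (Fobj p ε a b x t y s (u 1) (v 1) (w 1) - Fstar p ε a b x t y s)) 2 /
          (k : ℝ) := by
  have hF : ∀ u v w, Fobj p ε a b x t y s u v w = hbPhi ε a b u v (costM p x t y s w) :=
    fun _ _ _ => rfl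
  set M := CsupNorm p x t y s with hMd
  set K := matSup (tildeC p x t y s) with hKd
  have hlin : ∀ w w' i j, costM p x t y s w' i j =
      costM p x t y s w i j + (w' - w) * tildeC p x t y s i j := by
    intro w w' i j; simp only [costM, tildeC]; ring
  have hX0 : ∀ i j, 0 ≤ ∑ l, |x i l - y j l| ^ p :=
    fun i j => Finset.sum_nonneg fun l _ => Real.rpow_nonneg (abs_nonneg _) _
  have hT0 : ∀ i j, 0 ≤ |t i - s j| ^ p := fun i j => Real.rpow_nonneg (abs_nonneg _) _
  have hTM : ∀ i j, |t i - s j| ^ p ≤ M := by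
    intro i j
    have h1 := (le_abs_self _).trans (hb_le_matSup (costM p x t y s 0) i j)
    have h2 : costM p x t y s 0 i j = |t i - s j| ^ p := by simp [costM]
    rw [h2] at h1
    exact h1.trans (le_max_left _ _)
  have hXM : ∀ i j, ∑ l, |x i l - y j l| ^ p ≤ M := by
    intro i j
    have h1 := (le_abs_self _).trans (hb_le_matSup (costM p x t y s 1) i j)
    have h2 : costM p x t y s 1 i j = ∑ l, |x i l - y j l| ^ p := by simp [costM]
    rw [h2] at h1
    exact h1.trans (le_max_right _ _)
  have hM : 0 ≤ M := (hb_matSup_nonneg _).trans (le_max_left _ _)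
  have hK : 0 ≤ K := hb_matSup_nonneg _
  have hKM : K ≤ M := by
    refine hb_matSup_le _ _ hM fun i j => ?_
    have h1 := hX0 i j
    have h2 := hT0 i j
    have h3 := hXM i j
    have h4 := hTM i j
    simp only [tildeC]
    rw [abs_le]; constructor <;> linarith
  have hT : ∀ i j, |tildeC p x t y s i j| ≤ K := fun i j => hb_le_matSup _ i j
  have hC0 : ∀ w ∈ Set.Icc (0 : ℝ) 1, ∀ i j, 0 ≤ costM p x t y s w i j := by
    rintro w ⟨h0, h1⟩ i j
    exact add_nonneg (mul_nonneg h0 (hX0 i j)) (mul_nonneg (by linarith) (hT0 i j))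
  have hCM : ∀ w ∈ Set.Icc (0 : ℝ) 1, ∀ i j, costM p x t y s w i j ≤ M := by
    rintro w ⟨h0, h1⟩ i j
    have h2 := mul_le_mul_of_nonneg_left (hXM i j) h0
    have h3 := mul_le_mul_of_nonneg_left (hTM i j) (by linarith : 0 ≤ 1 - w)
    simp only [costM]
    linarith
  have hu : ∀ k, u (k + 1) = hbU ε a b (costM p x t y s (w k)) (v k) := fun k => (hseq k).1
  have hv : ∀ k, v (k + 1) = hbV ε a (costM p x t y s (w k)) (u (k + 1)) :=
    fun k => (hseq k).2.1
  have hw : ∀ k, w (k + 1) = min 1 (max 0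
      (w k - η * gradW p ε a b x t y s (u (k + 1)) (v (k + 1)) (w k))) := fun k => (hseq k).2.2
  have hwm : ∀ k, w k ∈ Set.Icc (0 : ℝ) 1 := by
    intro k
    cases k with
    | zero => exact hw0
    | succ k => rw [hw k]; exact hb_min_mem _
  have hub : ∀ k i, |u (k + 1) i| ≤ M := fun k i => by
    rw [hu]; exact hbU_bound ε hε hn a b ha ha1 hb M _ (hC0 _ (hwm k)) (hCM _ (hwm k)) _ i
  have hvb : ∀ k j, |v (k + 1) j| ≤ 2 * M := fun k j => by
    rw [hv]
    exact hbV_bound ε hε hm a ha ha1 M hM _ (hC0 _ (hwm k)) (hCM _ (hwm k)) _ (hub k) j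
  have hfeas : ∀ k, (u (k + 1), v (k + 1), w (k + 1)) ∈ feasSet (n := n) a := fun k => by
    refine ⟨?_, hwm (k + 1)⟩
    simp only [hu]
    exact hbU_center ε a b ha1 _ _
  have hstep := fun k => hb_step hm hn ε hε a b ha ha1 hb hb1 (costM p x t y s)
    (tildeC p x t y s) M K η hC0 hCM hlin hT hK hKM hη (u (k + 1)) (v k) (v (k + 1)) (w k)
    (w (k + 1)) (gradW p ε a b x t y s (u (k + 1)) (v (k + 1)) (w k)) (hwm k) (hu k) (hv k)
    rfl (hw k)
  -- every feasible point is dominated by a bounded one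
  have hcomp : ∀ ζ ∈ feasSet (m := m) (n := n) a, ∃ (u' : Fin m → ℝ) (v' : Fin n → ℝ),
      (∀ i, |u' i| ≤ M) ∧ (∀ j, |v' j| ≤ 2 * M) ∧
      hbPhi ε a b u' v' (costM p x t y s ζ.2.2) ≤
        hbPhi ε a b ζ.1 ζ.2.1 (costM p x t y s ζ.2.2) := by
    rintro ⟨u', v', w'⟩ ⟨_, hw'⟩
    simp only at hw' ⊢
    have hub' := hbU_bound ε hε hn a b ha ha1 hb M _ (hC0 _ hw') (hCM _ hw') v'
    refine ⟨hbU ε a b (costM p x t y s w') v',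
      hbV ε a (costM p x t y s w') (hbU ε a b (costM p x t y s w') v'), hub',
      hbV_bound ε hε hm a ha ha1 M hM _ (hC0 _ hw') (hCM _ hw') _ hub', ?_⟩
    obtain ⟨l, hrow⟩ := hbU_row ε hε hn a b hb (costM p x t y s w') v'
    have h1 := hb_row_min ε hε a b ha ha1 hb hb1 _ _ v' l hrow u'
    obtain ⟨q, _, _, _, _, hdec⟩ := hb_vstep ε hε hm a b ha ha1 hb hb1 _ _ _ hrow
    have h2 : 0 ≤ ε * (∑ j, b j * |q j - 1|) ^ 2 / 4 := by positivity
    linarith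
  set S := {r : ℝ | ∃ ζ : (Fin m → ℝ) × (Fin n → ℝ) × ℝ, ζ ∈ feasSet a ∧
    r = Fobj p ε a b x t y s ζ.1 ζ.2.1 ζ.2.2} with hS
  have hSne : S.Nonempty := ⟨_, _, hfeas 0, rfl⟩
  have hle : ∀ r B : ℝ, (∀ (u' : Fin m → ℝ) (v' : Fin n → ℝ) (w' : ℝ), (∀ i, |u' i| ≤ M) →
      (∀ j, |v' j| ≤ 2 * M) → w' ∈ Set.Icc (0 : ℝ) 1 →
      r - hbPhi ε a b u' v' (costM p x t y s w') ≤ B) → ∀ z ∈ S, r - B ≤ z := by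
    rintro r B h z ⟨ζ, hζ, rfl⟩
    obtain ⟨u', v', h1, h2, h3⟩ := hcomp ζ hζ
    have h4 := h u' v' ζ.2.2 h1 h2 hζ.2
    rw [hF]
    linarith
  set P := M ^ 2 / ε * Real.exp (6 * M / ε) with hP
  have hP0 : 0 ≤ P := by positivity
  have hlow := hle (Fobj p ε a b x t y s (u 1) (v 1) (w 1)) (8 * P)
    (fun u' v' w' h1 _ h3 => (hstep 0).1 u' v' w' h1 h3)
  have hbdd : BddBelow S := ⟨_, hlow⟩
  have hFs : Fstar p ε a b x t y s = sInf S := rfl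
  have hFle : ∀ k, Fstar p ε a b x t y s ≤
      Fobj p ε a b x t y s (u (k + 1)) (v (k + 1)) (w (k + 1)) := fun k => by
    rw [hFs]; exact csInf_le hbdd ⟨_, hfeas k, rfl⟩
  set R := (192 * (m : ℝ) + 216 * (n : ℝ) + 24) * (M ^ 2 / ε) * Real.exp (18 * M / ε) with hR
  have hPR : 200 * P ≤ R := by
    have hm' : (1 : ℝ) ≤ m := by exact_mod_cast hm
    have hn' : (1 : ℝ) ≤ n := by exact_mod_cast hn
    have he : Real.exp (6 * M / ε) ≤ Real.exp (18 * M / ε) := by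
      refine Real.exp_le_exp.2 (div_le_div_of_nonneg_right (by linarith) hε.le)
    have h1 : (200 : ℝ) ≤ 192 * (m : ℝ) + 216 * (n : ℝ) + 24 := by linarith
    rw [hP, hR, ← mul_assoc]
    gcongr
  have hR0 : 0 ≤ R := by linarith
  have hmain := hb_recur
    (fun k => Fobj p ε a b x t y s (u k) (v k) (w k) - Fstar p ε a b x t y s) R hR0 ?_ ?_
  · intro k hk
    refine (hmain k hk).trans ?_
    refine div_le_div_of_nonneg_right ?_ (Nat.cast_nonneg k)
    rw [mul_comm 2 R]
    exact mul_le_mul_of_nonneg_left (le_max_right _ _) hR0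
  · have : Fobj p ε a b x t y s (u 1) (v 1) (w 1) - 8 * P ≤ Fstar p ε a b x t y s := by
      rw [hFs]; exact le_csInf hSne hlow
    show Fobj p ε a b x t y s (u 1) (v 1) (w 1) - Fstar p ε a b x t y s ≤ 2 * R
    linarith
  · intro k hk
    obtain ⟨k, rfl⟩ : ∃ k', k = k' + 1 := ⟨k - 1, by omega⟩
    obtain ⟨Y, hY0, hD0, hY2, hYc⟩ := (hstep (k + 1)).2 (hvb k) (u (k + 1))
    have h1 : Fobj p ε a b x t y s (u (k + 1 + 1)) (v (k + 1 + 1)) (w (k + 1 + 1)) - Y ≤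
        Fstar p ε a b x t y s := by
      rw [hFs]
      exact le_csInf hSne (hle _ _ (fun u' v' w' _ h2 h3 => hYc u' v' w' h2 h3))
    have h2 := hFle (k + 1)
    rw [← hF, ← hF] at hY2 hD0
    have h3 : (Fobj p ε a b x t y s (u (k + 1 + 1)) (v (k + 1 + 1)) (w (k + 1 + 1)) -
        Fstar p ε a b x t y s) ^ 2 ≤ Y ^ 2 :=
      pow_le_pow_left₀ (by linarith) (by linarith) 2
    have h4 := mul_le_mul_of_nonneg_right hPR hD0
    show (Fobj p ε a b x t y s (u (k + 1 + 1)) (v (k + 1 + 1)) (w (k + 1 + 1)) -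
        Fstar p ε a b x t y s) ^ 2 ≤ _
    refine (h3.trans (hY2.trans h4)).trans_eq ?_
    ring
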